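/- arXiv:2008.01234 — 3 statements merged into one kernel-verified Lean document; each statement's English description precedes it below -/
import Mathlib

section
/- Up to isomorphism, the algebra D_res has exactly p simple modules, of dimensions 1, 3, 5, ..., 2p-1. Precisely: there exist simple D_res-modules L_0, ..., L_{p-1} with dim_k L_j = 2j+1, pairwise non-isomorphic, such that every simple D_res-module is isomorphic to exactly one L_j. -/
/-!
The double `D_res` of the restricted super Jordan plane, presented by
generators x1, x2, u1, u2, g, ζ and the relations of the paper, realized as
`RingQuot` of a relation on the free algebra on 6 generators.
-/

namespace RestrictedDouble

variable (k : Type) [Field k] (p : ℕ)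

noncomputable def fx1 : FreeAlgebra k (Fin 6) := FreeAlgebra.ι k 0
noncomputable def fx2 : FreeAlgebra k (Fin 6) := FreeAlgebra.ι k 1
noncomputable def fu1 : FreeAlgebra k (Fin 6) := FreeAlgebra.ι k 2
noncomputable def fu2 : FreeAlgebra k (Fin 6) := FreeAlgebra.ι k 3
noncomputable def fg  : FreeAlgebra k (Fin 6) := FreeAlgebra.ι k 4
noncomputable def fz  : FreeAlgebra k (Fin 6) := FreeAlgebra.ι k 5
noncomputable def fx21 : FreeAlgebra k (Fin 6) := fx1 k * fx2 k + fx2 k * fx1 k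
noncomputable def fu21 : FreeAlgebra k (Fin 6) := fu1 k * fu2 k + fu2 k * fu1 k

/-- The defining relations of `D_res`. -/
inductive Rel : FreeAlgebra k (Fin 6) → FreeAlgebra k (Fin 6) → Prop
  | x1sq   : Rel (fx1 k * fx1 k) 0
  | x2x21  : Rel (fx2 k * fx21 k) (fx21 k * fx2 k + fx1 k * fx21 k)
  | x21pow : Rel (fx21 k ^ p) 0
  | x2pow  : Rel (fx2 k ^ (2 * p)) 0
  | u1sq   : Rel (fu1 k * fu1 k) 0
  | u2u21  : Rel (fu2 k * fu21 k) (fu21 k * fu2 k + fu1 k * fu21 k)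
  | u21pow : Rel (fu21 k ^ p) 0
  | u2pow  : Rel (fu2 k ^ (2 * p)) 0
  | gpow   : Rel (fg k ^ p) 1
  | zpow   : Rel (fz k ^ p) (fz k)
  | zg     : Rel (fz k * fg k) (fg k * fz k)
  | gx1    : Rel (fg k * fx1 k) (fx1 k * fg k)
  | gx2    : Rel (fg k * fx2 k) (fx2 k * fg k - fx1 k * fg k)
  | u1g    : Rel (fu1 k * fg k) (fg k * fu1 k)
  | u2g    : Rel (fu2 k * fg k) (fg k * fu2 k - fg k * fu1 k)
  | zx1    : Rel (fz k * fx1 k) (fx1 k * fz k + fx1 k)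
  | zx2    : Rel (fz k * fx2 k) (fx2 k * fz k + fx2 k)
  | u1z    : Rel (fu1 k * fz k) (fz k * fu1 k + fu1 k)
  | u2z    : Rel (fu2 k * fz k) (fz k * fu2 k + fu2 k)
  | u1x1   : Rel (fu1 k * fx1 k) (-(fx1 k * fu1 k))
  | u1x2   : Rel (fu1 k * fx2 k) (-(fx2 k * fu1 k) + 1 - fg k)
  | u2x1   : Rel (fu2 k * fx1 k) (-(fx1 k * fu2 k) + 1 - fg k + fx1 k * fu1 k)
  | u2x2   : Rel (fu2 k * fx2 k) (-(fx2 k * fu2 k) + fg k * fz k + fx2 k * fu1 k)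

/-- The algebra `D_res`. -/
abbrev Dres := RingQuot (Rel k p)

noncomputable def x1 : Dres k p := RingQuot.mkAlgHom k (Rel k p) (fx1 k)
noncomputable def x2 : Dres k p := RingQuot.mkAlgHom k (Rel k p) (fx2 k)
noncomputable def u1 : Dres k p := RingQuot.mkAlgHom k (Rel k p) (fu1 k)
noncomputable def u2 : Dres k p := RingQuot.mkAlgHom k (Rel k p) (fu2 k)
noncomputable def g  : Dres k p := RingQuot.mkAlgHom k (Rel k p) (fg k)
noncomputable def z  : Dres k p := RingQuot.mkAlgHom k (Rel k p) (fz k)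
noncomputable def x21 : Dres k p := x1 k p * x2 k p + x2 k p * x1 k p
noncomputable def u21 : Dres k p := u1 k p * u2 k p + u2 k p * u1 k p

end RestrictedDouble


namespace RestrictedDouble

section Module

variable {k : Type} [Field k] {p : ℕ} {M : Type*} [AddCommGroup M] [Module (Dres k p) M]

/-- To prove a property of all elements of `D_res`, it suffices to prove it for scalars and for
the generators, and to check that it is preserved by sums and products. -/
theorem Dres.induction {C : Dres k p → Prop} (scalar : ∀ c : k, C (algebraMap k _ c))
    (hx1 : C (x1 k p)) (hx2 : C (x2 k p)) (hu1 : C (u1 k p)) (hu2 : C (u2 k p))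
    (hg : C (g k p)) (hz : C (z k p)) (mul : ∀ a b, C a → C b → C (a * b))
    (add : ∀ a b, C a → C b → C (a + b)) (d : Dres k p) : C d := by
  obtain ⟨a, rfl⟩ := RingQuot.mkAlgHom_surjective k (Rel k p) d
  induction a using FreeAlgebra.induction with
  | grade0 r => simpa using scalar r
  | grade1 i =>
    fin_cases i
    exacts [hx1, hx2, hu1, hu2, hg, hz]
  | mul a b ha hb => simpa using mul _ _ ha hb
  | add a b ha hb => simpa using add _ _ ha hb

theorem x1_smul_x1 (m : M) : x1 k p • x1 k p • m = 0 := by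
  have h := congrArg (· • m) (RingQuot.mkAlgHom_rel k (Rel.x1sq (k := k) (p := p)))
  simp only [map_mul, map_zero, mul_smul, zero_smul] at h
  exact h

theorem u1_smul_u1 (m : M) : u1 k p • u1 k p • m = 0 := by
  have h := congrArg (· • m) (RingQuot.mkAlgHom_rel k (Rel.u1sq (k := k) (p := p)))
  simp only [map_mul, map_zero, mul_smul, zero_smul] at h
  exact h

theorem x2_smul_x21 (m : M) :
    x2 k p • (x1 k p • x2 k p • m + x2 k p • x1 k p • m) =
      x1 k p • x2 k p • x2 k p • m + x2 k p • x1 k p • x2 k p • m +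
        x1 k p • x2 k p • x1 k p • m := by
  have h := congrArg (· • m) (RingQuot.mkAlgHom_rel k (Rel.x2x21 (k := k) (p := p)))
  simp only [fx21, map_mul, map_add, mul_smul, add_smul, smul_add] at h ⊢
  refine h.trans ?_
  rw [← x1, x1_smul_x1, zero_add]
  rfl

theorem u2_smul_u21 (m : M) :
    u2 k p • (u1 k p • u2 k p • m + u2 k p • u1 k p • m) =
      u1 k p • u2 k p • u2 k p • m + u2 k p • u1 k p • u2 k p • m +
        u1 k p • u2 k p • u1 k p • m := by
  have h := congrArg (· • m) (RingQuot.mkAlgHom_rel k (Rel.u2u21 (k := k) (p := p)))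
  simp only [fu21, map_mul, map_add, mul_smul, add_smul, smul_add] at h ⊢
  refine h.trans ?_
  rw [← u1, u1_smul_u1, zero_add]
  rfl

theorem z_smul_g (m : M) : z k p • g k p • m = g k p • z k p • m := by
  have h := congrArg (· • m) (RingQuot.mkAlgHom_rel k (Rel.zg (k := k) (p := p)))
  simp only [map_mul, mul_smul] at h
  exact h

theorem g_smul_x1 (m : M) : g k p • x1 k p • m = x1 k p • g k p • m := by
  have h := congrArg (· • m) (RingQuot.mkAlgHom_rel k (Rel.gx1 (k := k) (p := p)))
  simp only [map_mul, mul_smul] at h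
  exact h

theorem g_smul_x2 (m : M) :
    g k p • x2 k p • m = x2 k p • g k p • m - x1 k p • g k p • m := by
  have h := congrArg (· • m) (RingQuot.mkAlgHom_rel k (Rel.gx2 (k := k) (p := p)))
  simp only [map_mul, map_sub, mul_smul, sub_smul] at h
  exact h

theorem u1_smul_g (m : M) : u1 k p • g k p • m = g k p • u1 k p • m := by
  have h := congrArg (· • m) (RingQuot.mkAlgHom_rel k (Rel.u1g (k := k) (p := p)))
  simp only [map_mul, mul_smul] at h
  exact h

theorem u2_smul_g (m : M) :
    u2 k p • g k p • m = g k p • u2 k p • m - g k p • u1 k p • m := by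
  have h := congrArg (· • m) (RingQuot.mkAlgHom_rel k (Rel.u2g (k := k) (p := p)))
  simp only [map_mul, map_sub, mul_smul, sub_smul] at h
  exact h

theorem z_smul_x1 (m : M) : z k p • x1 k p • m = x1 k p • z k p • m + x1 k p • m := by
  have h := congrArg (· • m) (RingQuot.mkAlgHom_rel k (Rel.zx1 (k := k) (p := p)))
  simp only [map_mul, map_add, mul_smul, add_smul] at h
  exact h

theorem z_smul_x2 (m : M) : z k p • x2 k p • m = x2 k p • z k p • m + x2 k p • m := by
  have h := congrArg (· • m) (RingQuot.mkAlgHom_rel k (Rel.zx2 (k := k) (p := p)))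
  simp only [map_mul, map_add, mul_smul, add_smul] at h
  exact h

theorem u1_smul_z (m : M) : u1 k p • z k p • m = z k p • u1 k p • m + u1 k p • m := by
  have h := congrArg (· • m) (RingQuot.mkAlgHom_rel k (Rel.u1z (k := k) (p := p)))
  simp only [map_mul, map_add, mul_smul, add_smul] at h
  exact h

theorem u2_smul_z (m : M) : u2 k p • z k p • m = z k p • u2 k p • m + u2 k p • m := by
  have h := congrArg (· • m) (RingQuot.mkAlgHom_rel k (Rel.u2z (k := k) (p := p)))
  simp only [map_mul, map_add, mul_smul, add_smul] at h
  exact h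

theorem u1_smul_x1 (m : M) : u1 k p • x1 k p • m = -(x1 k p • u1 k p • m) := by
  have h := congrArg (· • m) (RingQuot.mkAlgHom_rel k (Rel.u1x1 (k := k) (p := p)))
  simp only [map_mul, map_neg, mul_smul, neg_smul] at h
  exact h

theorem u1_smul_x2 (m : M) :
    u1 k p • x2 k p • m = -(x2 k p • u1 k p • m) + m - g k p • m := by
  have h := congrArg (· • m) (RingQuot.mkAlgHom_rel k (Rel.u1x2 (k := k) (p := p)))
  simp only [map_mul, map_add, map_sub, map_neg, map_one, mul_smul, neg_smul, add_smul, sub_smul,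
    one_smul] at h
  exact h

theorem u2_smul_x1 (m : M) :
    u2 k p • x1 k p • m = -(x1 k p • u2 k p • m) + m - g k p • m + x1 k p • u1 k p • m := by
  have h := congrArg (· • m) (RingQuot.mkAlgHom_rel k (Rel.u2x1 (k := k) (p := p)))
  simp only [map_mul, map_add, map_sub, map_neg, map_one, mul_smul, neg_smul, add_smul, sub_smul,
    one_smul] at h
  exact h

theorem u2_smul_x2 (m : M) :
    u2 k p • x2 k p • m =
      -(x2 k p • u2 k p • m) + g k p • z k p • m + x2 k p • u1 k p • m := by
  have h := congrArg (· • m) (RingQuot.mkAlgHom_rel k (Rel.u2x2 (k := k) (p := p)))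
  simp only [map_mul, map_add, map_neg, mul_smul, neg_smul, add_smul] at h
  exact h

theorem x2_pow : x2 k p ^ (2 * p) = 0 := by
  have h := RingQuot.mkAlgHom_rel k (Rel.x2pow (k := k) (p := p))
  simp only [map_pow, map_zero] at h
  exact h

theorem u2_pow : u2 k p ^ (2 * p) = 0 := by
  have h := RingQuot.mkAlgHom_rel k (Rel.u2pow (k := k) (p := p))
  simp only [map_pow, map_zero] at h
  exact h

theorem x21_pow : x21 k p ^ p = 0 := by
  have h := RingQuot.mkAlgHom_rel k (Rel.x21pow (k := k) (p := p))
  simp only [map_pow, map_zero, fx21, map_add, map_mul] at h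
  exact h

theorem u21_pow : u21 k p ^ p = 0 := by
  have h := RingQuot.mkAlgHom_rel k (Rel.u21pow (k := k) (p := p))
  simp only [map_pow, map_zero, fu21, map_add, map_mul] at h
  exact h

theorem g_pow : g k p ^ p = 1 := by
  have h := RingQuot.mkAlgHom_rel k (Rel.gpow (k := k) (p := p))
  simp only [map_pow, map_one] at h
  exact h

theorem z_pow : z k p ^ p = z k p := by
  have h := RingQuot.mkAlgHom_rel k (Rel.zpow (k := k) (p := p))
  simp only [map_pow] at h
  exact h

theorem g_sub_one_pow [Fact p.Prime] [CharP k p] : (g k p - 1) ^ p = 0 := by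
  have h := congrArg (Polynomial.aeval (g k p))
    (sub_pow_char (p := p) (Polynomial.X : Polynomial k) 1)
  simpa [g_pow] using h

theorem x21_smul (m : M) : x21 k p • m = x1 k p • x2 k p • m + x2 k p • x1 k p • m := by
  simp only [x21, add_smul, mul_smul]

theorem u21_smul (m : M) : u21 k p • m = u1 k p • u2 k p • m + u2 k p • u1 k p • m := by
  simp only [u21, add_smul, mul_smul]

theorem u21_smul_x1 (m : M) : u21 k p • x1 k p • m = x1 k p • u21 k p • m := by
  simp only [u21_smul, u1_smul_x1, u2_smul_x1, u1_smul_g, u1_smul_u1, smul_add, smul_sub,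
    smul_neg, smul_zero]
  abel

theorem u21_smul_x2 (m : M) :
    u21 k p • x2 k p • m = x2 k p • u21 k p • m + (u1 k p • m + g k p • u1 k p • m) := by
  simp only [u21_smul, u1_smul_x2, u2_smul_x2, u1_smul_g, u2_smul_g,
    u1_smul_z, u1_smul_u1, smul_add, smul_sub, smul_neg, smul_zero]
  abel

/-- A nilpotent operator preserving a predicate kills a nonzero vector satisfying it. -/
theorem exists_smul_eq_zero {R N : Type*} [Ring R] [AddCommGroup N] [Module R N] {f : R} {n : ℕ}
    (hf : f ^ n = 0) {P : N → Prop} (hP : ∀ m, P m → P (f • m)) {m : N} (hm : m ≠ 0) (hPm : P m) :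
    ∃ m', m' ≠ 0 ∧ P m' ∧ f • m' = 0 := by
  have h : f ^ n • m = 0 := by rw [hf, zero_smul]
  clear hf
  induction n generalizing m with
  | zero => exact absurd (by simpa using h) hm
  | succ n ih =>
    by_cases h0 : f • m = 0
    · exact ⟨m, hm, hPm, h0⟩
    · exact ih h0 (hP m hPm) (by rwa [smul_smul, ← pow_succ])

/-- The common kernel of the normal subalgebra generated by `x1`, `x21`, `g`, `u1`, `u21`. -/
structure IsInvariant (m : M) : Prop where
  x1_smul : x1 k p • m = 0
  u1_smul : u1 k p • m = 0
  g_smul : g k p • m = m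
  x1_smul_x2_smul : x1 k p • x2 k p • m = 0
  u1_smul_u2_smul : u1 k p • u2 k p • m = 0

theorem exists_isInvariant [Fact p.Prime] [CharP k p] [Nontrivial M] :
    ∃ m : M, m ≠ 0 ∧ IsInvariant (k := k) (p := p) m := by
  obtain ⟨m, hm⟩ := exists_ne (0 : M)
  have hx1 : x1 k p ^ 2 = 0 := by simpa [sq] using x1_smul_x1 (k := k) (p := p) (1 : Dres k p)
  have hu1 : u1 k p ^ 2 = 0 := by simpa [sq] using u1_smul_u1 (k := k) (p := p) (1 : Dres k p)
  obtain ⟨m, hm, -, h1⟩ := exists_smul_eq_zero hx1 (P := fun _ : M => True)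
    (fun _ _ => trivial) hm trivial
  obtain ⟨m, hm, h1, h2⟩ := exists_smul_eq_zero hu1
    (P := fun m : M => x1 k p • m = 0) (fun m h => by
      simpa [h] using u1_smul_x1 (k := k) (p := p) m) hm h1
  obtain ⟨m, hm, ⟨h1, h2⟩, h3⟩ := exists_smul_eq_zero (g_sub_one_pow (k := k) (p := p))
    (P := fun m : M => x1 k p • m = 0 ∧ u1 k p • m = 0) (fun m h => by
      simp [sub_smul, smul_sub, ← g_smul_x1, u1_smul_g, h]) hm ⟨h1, h2⟩
  obtain ⟨m, hm, ⟨h1, h2, h3⟩, h4⟩ := exists_smul_eq_zero (x21_pow (k := k) (p := p))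
    (P := fun m : M => x1 k p • m = 0 ∧ u1 k p • m = 0 ∧ g k p • m = m) (fun m h => by
      simp [x21_smul, g_smul_x1, g_smul_x2, u1_smul_x1, u1_smul_x2, x1_smul_x1, h])
    hm ⟨h1, h2, by simpa [sub_smul, sub_eq_zero] using h3⟩
  obtain ⟨m, hm, ⟨h1, h2, h3, h4⟩, h5⟩ := exists_smul_eq_zero (u21_pow (k := k) (p := p))
    (P := fun m : M => x1 k p • m = 0 ∧ u1 k p • m = 0 ∧ g k p • m = m ∧
      x1 k p • x2 k p • m = 0) (fun m ⟨h1, h2, h3, h4⟩ => by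
      have h5 : g k p • u2 k p • m = u2 k p • m := by
        simpa [h2, h3] using (u2_smul_g (k := k) (p := p) m).symm
      refine ⟨?_, ?_, ?_, ?_⟩
      · rw [← u21_smul_x1, h1, smul_zero]
      · simp [u21_smul, h2, u1_smul_u1]
      · simp [u21_smul, h2, ← u1_smul_g, h5]
      · have h6 : x2 k p • u21 k p • m = u21 k p • x2 k p • m := by simp [u21_smul_x2, h2]
        rw [h6, ← u21_smul_x1, h4, smul_zero]) hm
      ⟨h1, h2, h3, by simpa [x21_smul, h1] using h4⟩
  exact ⟨m, hm, h1, h2, h3, h4, by simpa [u21_smul, h2] using h5⟩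

theorem IsInvariant.smul (d : Dres k p) {m : M} (hm : IsInvariant (k := k) (p := p) m) :
    IsInvariant (k := k) (p := p) (d • m) := by
  induction d using Dres.induction generalizing m with
  | scalar c =>
    obtain ⟨h1, h2, h3, h4, h5⟩ := hm
    have comm (a : Dres k p) (m : M) : a • algebraMap k (Dres k p) c • m =
      algebraMap k (Dres k p) c • a • m := by rw [smul_smul, ← Algebra.commutes, mul_smul]
    constructor <;> simp [comm, h1, h2, h3, h4, h5]
  | hx1 => simp only [hm.x1_smul]; constructor <;> simp
  | hu1 => simp only [hm.u1_smul]; constructor <;> simp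
  | hg => simpa only [hm.g_smul] using hm
  | hx2 =>
    obtain ⟨h1, h2, h3, h4, h5⟩ := hm
    have h6 : u1 k p • x2 k p • m = 0 := by simp [u1_smul_x2, h2, h3]
    refine ⟨h4, h6, ?_, ?_, ?_⟩
    · simp [g_smul_x2, h1, h3]
    · simpa [h1, h4] using (x2_smul_x21 (k := k) (p := p) m).symm
    · simpa [u21_smul, h2, h5, h6] using u21_smul_x2 (k := k) (p := p) m
  | hu2 =>
    obtain ⟨h1, h2, h3, h4, h5⟩ := hm
    have h6 : x1 k p • u2 k p • m = 0 := by
      simpa [h1, h2, h3] using u2_smul_x1 (k := k) (p := p) m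
    have h7 : u1 k p • x2 k p • m = 0 := by simp [u1_smul_x2, h2, h3]
    have h8 : g k p • x2 k p • m = x2 k p • m := by simp [g_smul_x2, h1, h3]
    have h9 : x1 k p • z k p • m = 0 := by
      simpa [h1] using (z_smul_x1 (k := k) (p := p) m).symm
    have h10 : x1 k p • u2 k p • x2 k p • m = 0 := by
      simpa [h4, h7, h8] using u2_smul_x1 (k := k) (p := p) (x2 k p • m)
    refine ⟨h6, h5, ?_, ?_, ?_⟩
    · simpa [h2, h3] using (u2_smul_g (k := k) (p := p) m).symm
    · simpa [h2, h9, h10, ← z_smul_g, h3] using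
        congrArg (x1 k p • ·) (u2_smul_x2 (k := k) (p := p) m)
    · simpa [h2, h5] using (u2_smul_u21 (k := k) (p := p) m).symm
  | hz =>
    obtain ⟨h1, h2, h3, h4, h5⟩ := hm
    refine ⟨?_, ?_, ?_, ?_, ?_⟩
    · simpa [h1] using (z_smul_x1 (k := k) (p := p) m).symm
    · simp [u1_smul_z, h2]
    · rw [← z_smul_g, h3]
    · have h6 : x1 k p • z k p • x2 k p • m = 0 := by
        simpa [h4] using (z_smul_x1 (k := k) (p := p) (x2 k p • m)).symm
      simpa [h4, h6] using (congrArg (x1 k p • ·) (z_smul_x2 (k := k) (p := p) m)).symm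
    · simp [u2_smul_z, u1_smul_z, h5]
  | mul a b ha hb => rw [mul_smul]; exact ha (hb hm)
  | add a b ha hb =>
    rw [add_smul]
    obtain ⟨h1, h2, h3, h4, h5⟩ := ha hm
    obtain ⟨h1', h2', h3', h4', h5'⟩ := hb hm
    constructor <;> simp [*]

end Module

section SimpleModule

variable {k : Type} [Field k] {p : ℕ} {M : Type*} [AddCommGroup M] [Module (Dres k p) M]

/-- On a simple module every vector is invariant under the normal subalgebra generated by
`x1`, `x21`, `g`, `u1`, `u21`. -/
theorem isInvariant_of_isSimpleModule [Fact p.Prime] [CharP k p] [IsSimpleModule (Dres k p) M]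
    (m : M) : IsInvariant (k := k) (p := p) m := by
  have : Nontrivial M := IsSimpleModule.nontrivial (Dres k p) M
  obtain ⟨v, hv, hinv⟩ := exists_isInvariant (k := k) (p := p) (M := M)
  obtain ⟨d, rfl⟩ := (isSimpleModule_iff_toSpanSingleton_surjective.mp ‹_›).2 v hv m
  exact hinv.smul d

theorem prod_X_sub_C_zmod [Fact p.Prime] [CharP k p] :
    ∏ a : ZMod p, (Polynomial.X - Polynomial.C (ZMod.castHom dvd_rfl k a)) =
      (Polynomial.X ^ p - Polynomial.X : Polynomial k) := by
  have hp : 1 < p := (Fact.out : p.Prime).one_lt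
  have hroots := FiniteField.roots_X_pow_card_sub_X (ZMod p)
  have h := Polynomial.prod_multiset_X_sub_C_of_monic_of_roots_card_eq
    (p := (Polynomial.X ^ p - Polynomial.X : Polynomial (ZMod p)))
    (Polynomial.monic_X_pow_sub (by simpa using hp))
    (by rw [ZMod.card] at hroots
        rw [hroots, FiniteField.X_pow_card_sub_X_natDegree_eq _ hp]; simp)
  rw [ZMod.card] at hroots
  rw [hroots] at h
  simpa [Polynomial.map_prod] using
    congrArg (Polynomial.map (ZMod.castHom dvd_rfl k)) h

variable [Module k M] [IsScalarTower k (Dres k p) M]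

theorem exists_smul_eq_smul {ι : Type*} (s : Finset ι) (c : ι → k) {f : Dres k p} {P : M → Prop}
    (hP : ∀ a m, P m → P (f • m - c a • m)) {m : M} (hm : m ≠ 0) (hPm : P m)
    (h : Polynomial.aeval f (∏ a ∈ s, (Polynomial.X - Polynomial.C (c a))) • m = 0) :
    ∃ a, ∃ m', m' ≠ 0 ∧ P m' ∧ f • m' = c a • m' := by
  classical
  induction s using Finset.induction_on generalizing m with
  | empty => exact absurd (by simpa using h) hm
  | insert a s ha ih =>
    by_cases h0 : f • m - c a • m = 0
    · exact ⟨a, m, hm, hPm, sub_eq_zero.mp h0⟩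
    · refine ih h0 (hP a m hPm) ?_
      rw [Finset.prod_insert ha, mul_comm, map_mul, mul_smul] at h
      simpa [sub_smul] using h

/-- A simple module contains a highest weight vector. -/
theorem exists_highestWeight [Fact p.Prime] [CharP k p] [IsSimpleModule (Dres k p) M] :
    ∃ (j : Fin p) (v : M), v ≠ 0 ∧ u2 k p • v = 0 ∧ z k p • v = (-(j : ℕ) : k) • v := by
  have : Nontrivial M := IsSimpleModule.nontrivial (Dres k p) M
  obtain ⟨m, hm⟩ := exists_ne (0 : M)
  obtain ⟨m, hm, -, hu⟩ := exists_smul_eq_zero (u2_pow (k := k) (p := p))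
    (P := fun _ : M => True) (fun _ _ => trivial) hm trivial
  obtain ⟨a, v, hv, hu, hz⟩ := exists_smul_eq_smul (f := z k p) Finset.univ
    (ZMod.castHom dvd_rfl k) (P := fun m : M => u2 k p • m = 0)
    (fun a m h => by rw [smul_sub, u2_smul_z, h, smul_comm, h]; simp) hm hu
    (by rw [prod_X_sub_C_zmod]; simp [z_pow])
  refine ⟨⟨(-a).val, ZMod.val_lt _⟩, v, hv, hu, ?_⟩
  rw [hz]
  congr 1
  rw [ZMod.natCast_val, ← ZMod.castHom_apply (h := dvd_rfl), map_neg, neg_neg]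

/-- The scalars by which `u2` lowers the vectors `x2 ^ i • v`, for `v` of highest weight `μ`. -/
def ladderCoeff (μ : k) (i : ℕ) : k := if Even i then ((i / 2 : ℕ) : k) else ((i / 2 : ℕ) : k) + μ

theorem ladderCoeff_even (μ : k) (m : ℕ) : ladderCoeff μ (2 * m) = m := by
  simp [ladderCoeff]

theorem ladderCoeff_odd (μ : k) (m : ℕ) : ladderCoeff μ (2 * m + 1) = m + μ := by
  have h : (2 * m + 1) / 2 = m := by omega
  simp [ladderCoeff, h]

theorem ladderCoeff_zero (μ : k) : ladderCoeff μ 0 = 0 := by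
  simp [ladderCoeff]

theorem ladderCoeff_succ (μ : k) (i : ℕ) :
    ladderCoeff μ (i + 1) = -ladderCoeff μ i + (i + μ) := by
  obtain ⟨m, rfl | rfl⟩ := i.even_or_odd'
  · rw [ladderCoeff_odd, ladderCoeff_even]; push_cast; ring
  · rw [show 2 * m + 1 + 1 = 2 * (m + 1) by ring, ladderCoeff_odd, ladderCoeff_even]
    push_cast; ring

theorem ladderCoeff_ne_zero [CharP k p] {j : ℕ} (hj : j < p) {i : ℕ} (h0 : i ≠ 0)
    (hi : i < 2 * j + 1) : ladderCoeff (-j : k) i ≠ 0 := by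
  have cast_ne {n : ℕ} (h0 : n ≠ 0) (hn : n < p) : (n : k) ≠ 0 := by
    rw [Ne, CharP.cast_eq_zero_iff k p]
    exact fun h => absurd (Nat.le_of_dvd (by omega) h) (by omega)
  obtain ⟨m, rfl | rfl⟩ := i.even_or_odd'
  · rw [ladderCoeff_even]
    exact cast_ne (by omega) (by omega)
  · rw [ladderCoeff_odd, ← sub_eq_add_neg, ← neg_ne_zero, neg_sub, ← Nat.cast_sub (by omega)]
    exact cast_ne (by omega) (by omega)

theorem z_smul_x2_pow {μ : k} {v : M} (hz : z k p • v = μ • v) (i : ℕ) :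
    z k p • x2 k p ^ i • v = (i + μ) • x2 k p ^ i • v := by
  induction i with
  | zero => simpa using hz
  | succ i ih =>
    rw [pow_succ', mul_smul, z_smul_x2, ih, smul_comm]
    generalize x2 k p • x2 k p ^ i • v = w
    push_cast
    module

theorem u2_smul_x2_pow (hM : ∀ m : M, IsInvariant (k := k) (p := p) m) {μ : k} {v : M}
    (hu : u2 k p • v = 0) (hz : z k p • v = μ • v) (i : ℕ) :
    u2 k p • x2 k p ^ (i + 1) • v = ladderCoeff μ (i + 1) • x2 k p ^ i • v := by
  induction i with
  | zero => simp [ladderCoeff_succ, ladderCoeff_zero, u2_smul_x2, hu, (hM _).g_smul,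
      (hM _).u1_smul, hz]
  | succ i ih =>
    rw [pow_succ', mul_smul, u2_smul_x2, ih, (hM _).g_smul, (hM _).u1_smul, z_smul_x2_pow hz,
      ladderCoeff_succ μ (i + 1), smul_comm, ← mul_smul (x2 k p), ← pow_succ', smul_zero, add_zero]
    generalize x2 k p ^ (i + 1) • v = w
    module

/-- In a simple module, the ladder generated by a highest weight vector has no other vector
killed by `u2`. -/
theorem x2_pow_smul_eq_zero [Fact p.Prime] [CharP k p] [IsSimpleModule (Dres k p) M] {μ : k} {v : M}
    (hu : u2 k p • v = 0) (hz : z k p • v = μ • v) {i : ℕ} (hi : ladderCoeff μ (i + 1) = 0) :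
    x2 k p ^ (i + 1) • v = 0 := by
  have hM := isInvariant_of_isSimpleModule (k := k) (p := p) (M := M)
  have : Nontrivial M := IsSimpleModule.nontrivial (Dres k p) M
  by_contra hw
  have huw : u2 k p • x2 k p ^ (i + 1) • v = 0 := by rw [u2_smul_x2_pow hM hu hz, hi, zero_smul]
  have hzw := z_smul_x2_pow hz (i + 1)
  set S := Submodule.span k (Set.range fun n : ℕ => x2 k p ^ n • x2 k p ^ (i + 1) • v) with hS
  have mem (n : ℕ) : x2 k p ^ n • x2 k p ^ (i + 1) • v ∈ S := Submodule.subset_span ⟨n, rfl⟩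
  have stable_of (d : Dres k p) (hd : ∀ n, d • x2 k p ^ n • x2 k p ^ (i + 1) • v ∈ S) (m : M)
      (hm : m ∈ S) : d • m ∈ S := by
    have : S ≤ S.comap (Algebra.lsmul k k M d) := by
      rw [hS, Submodule.span_le, ← hS]
      rintro _ ⟨n, rfl⟩
      exact hd n
    exact this hm
  have stable (d : Dres k p) : ∀ m ∈ S, d • m ∈ S := by
    induction d using Dres.induction with
    | scalar c => intro m hm; rw [algebraMap_smul]; exact S.smul_mem c hm
    | hx1 => intro m hm; simp [(hM _).x1_smul]
    | hu1 => intro m hm; simp [(hM _).u1_smul]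
    | hg => intro m hm; rwa [(hM _).g_smul]
    | hx2 => exact stable_of _ fun n => by rw [← mul_smul, ← pow_succ']; exact mem _
    | hz => exact stable_of _ fun n => by rw [z_smul_x2_pow hzw]; exact S.smul_mem _ (mem _)
    | hu2 =>
      refine stable_of _ fun n => ?_
      rcases n with _ | n
      · simp [huw]
      · rw [u2_smul_x2_pow hM huw hzw]
        exact S.smul_mem _ (mem _)
    | mul a b ha hb => intro m hm; rw [mul_smul]; exact ha _ (hb _ hm)
    | add a b ha hb => intro m hm; rw [add_smul]; exact S.add_mem (ha _ hm) (hb _ hm)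
  have hrange : S ≤ LinearMap.range (Algebra.lsmul k k M (x2 k p)) := by
    rw [hS, Submodule.span_le]
    rintro _ ⟨n, rfl⟩
    refine ⟨x2 k p ^ (n + i) • v, ?_⟩
    simp only [Algebra.lsmul_coe]
    rw [← mul_smul, ← mul_smul, ← pow_succ', ← pow_add, add_assoc]
  have hsurj (n : ℕ) (m : M) : ∃ m', x2 k p ^ n • m' = m := by
    induction n with
    | zero => exact ⟨m, by simp⟩
    | succ n ih =>
      obtain ⟨m', rfl⟩ := ih
      obtain ⟨d, rfl⟩ := (isSimpleModule_iff_toSpanSingleton_surjective.mp ‹_›).2 _ hw m'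
      obtain ⟨m'', hm''⟩ := hrange (stable d _ (by simpa using mem 0))
      exact ⟨m'', by rw [pow_succ, mul_smul]; exact congrArg _ hm''⟩
  obtain ⟨m', hm'⟩ := hsurj (2 * p) v
  rw [x2_pow, zero_smul] at hm'
  exact hw (by rw [← hm', smul_zero])

end SimpleModule

section Ladder

variable (k : Type) [Field k]

/-- The raising operator on `k ^ n`, `n = 2 * j + 1`. -/
def raise (j : ℕ) : Module.End k (Fin (2 * j + 1) → k) where
  toFun f := Fin.cons 0 fun i => f i.castSucc
  map_add' f h := by ext i; refine Fin.cases ?_ (fun i => ?_) i <;> simp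
  map_smul' c f := by ext i; refine Fin.cases ?_ (fun i => ?_) i <;> simp

/-- The lowering operator on `k ^ n`, `n = 2 * j + 1`. -/
def lower (j : ℕ) : Module.End k (Fin (2 * j + 1) → k) where
  toFun f := Fin.snoc (fun i => ladderCoeff (-j : k) (i + 1) * f i.succ) 0
  map_add' f h := by ext i; refine Fin.lastCases ?_ (fun i => ?_) i <;> simp [mul_add]
  map_smul' c f := by ext i; refine Fin.lastCases ?_ (fun i => ?_) i <;> simp [mul_left_comm]

/-- The weight operator on `k ^ n`, `n = 2 * j + 1`. -/
def weight (j : ℕ) : Module.End k (Fin (2 * j + 1) → k) where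
  toFun f i := ((i : ℕ) + (-j : k)) * f i
  map_add' f h := by ext i; simp [mul_add]
  map_smul' c f := by ext i; simp [mul_left_comm]

variable {k} {j : ℕ} (f : Fin (2 * j + 1) → k)

@[simp]
theorem raise_zero : raise k j f 0 = 0 := rfl

@[simp]
theorem raise_succ (i : Fin (2 * j)) : raise k j f i.succ = f i.castSucc := rfl

@[simp]
theorem lower_last : lower k j f (Fin.last _) = 0 := by simp [lower]

@[simp]
theorem lower_castSucc (i : Fin (2 * j)) :
    lower k j f i.castSucc = ladderCoeff (-j : k) (i + 1) * f i.succ := by simp [lower]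

@[simp]
theorem weight_apply (i : Fin (2 * j + 1)) :
    weight k j f i = ((i : ℕ) + (-j : k)) * f i := rfl

theorem raise_pow_apply (n : ℕ) (i : Fin (2 * j + 1)) (hi : (i : ℕ) < n) :
    (raise k j ^ n) f i = 0 := by
  induction n generalizing i with
  | zero => omega
  | succ n ih =>
    rw [pow_succ', Module.End.mul_apply]
    refine Fin.cases (fun _ => rfl) (fun i hi => ?_) i hi
    exact ih _ (by simpa using hi)

theorem lower_pow_apply (n : ℕ) (i : Fin (2 * j + 1)) (hi : 2 * j < i + n) :
    (lower k j ^ n) f i = 0 := by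
  induction n generalizing i with
  | zero => omega
  | succ n ih =>
    rw [pow_succ', Module.End.mul_apply]
    refine Fin.lastCases (fun _ => by simp) (fun i hi => ?_) i hi
    rw [lower_castSucc, ih _ (by simp at hi ⊢; omega), mul_zero]

theorem lower_raise_apply (i : Fin (2 * j + 1)) :
    lower k j (raise k j f) i = ladderCoeff (-j : k) (i + 1) * f i := by
  refine Fin.lastCases ?_ (fun i => ?_) i
  · simp [ladderCoeff_odd]
  · simp

theorem raise_lower_apply (i : Fin (2 * j + 1)) :
    raise k j (lower k j f) i = ladderCoeff (-j : k) i * f i := by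
  refine Fin.cases ?_ (fun i => ?_) i
  · simp [ladderCoeff_zero]
  · simp

theorem weight_pow_char {p : ℕ} [Fact p.Prime] [CharP k p] : weight k j ^ p = weight k j := by
  have h (n : ℕ) (f : Fin (2 * j + 1) → k) (i) :
      (weight k j ^ n) f i = ((i : ℕ) + (-j : k)) ^ n * f i := by
    induction n generalizing f with
    | zero => simp
    | succ n ih => rw [pow_succ, Module.End.mul_apply, ih, weight_apply, pow_succ, mul_assoc]
  refine LinearMap.ext fun f => funext fun i => ?_
  rw [h, weight_apply]
  congr 1
  have hfrob := map_intCast (frobenius k p) ((i : ℕ) - (j : ℕ) : ℤ)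
  rw [frobenius_def] at hfrob
  push_cast at hfrob
  rwa [sub_eq_add_neg] at hfrob

end Ladder

section Ladder

variable (k : Type) [Field k] {p : ℕ} [Fact p.Prime] [CharP k p]

/-- The representation of `D_res` on `k ^ (2 * j + 1)`. -/
noncomputable def ladderRep (j : Fin p) : Dres k p →ₐ[k] Module.End k (Fin (2 * (j : ℕ) + 1) → k) :=
  RingQuot.liftAlgHom k
    ⟨FreeAlgebra.lift k ![0, raise k j, 0, lower k j, 1, weight k j], by
      have hp : 0 < p := (Fact.out : p.Prime).pos
      intro a b h
      cases h
      case x2pow =>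
        refine LinearMap.ext fun f => funext fun i => ?_
        simpa [fx2] using raise_pow_apply f (2 * p) i (by omega)
      case u2pow =>
        refine LinearMap.ext fun f => funext fun i => ?_
        simpa [fu2] using lower_pow_apply f (2 * p) i (by omega)
      case zpow => simpa [fz] using weight_pow_char
      case zx2 =>
        refine LinearMap.ext fun f => funext fun i => ?_
        simp only [fz, fx2, map_mul, map_add, FreeAlgebra.lift_ι_apply]
        refine Fin.cases ?_ (fun i => ?_) i
        · simp
        · simp; ring
      case u2z =>
        refine LinearMap.ext fun f => funext fun i => ?_
        simp only [fz, fu2, map_mul, map_add, FreeAlgebra.lift_ι_apply]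
        refine Fin.lastCases ?_ (fun i => ?_) i
        · simp
        · simp; ring
      case u2x2 =>
        refine LinearMap.ext fun f => funext fun i => ?_
        simp [fz, fu2, fx2, fg, fu1, lower_raise_apply, raise_lower_apply, ladderCoeff_succ]
        ring
      all_goals simp [fx1, fx2, fu1, fu2, fg, fz, fx21, fu21, hp.ne']⟩

variable (p) in
/-- The simple module of dimension `2 * j + 1`. -/
abbrev Ladder (j : Fin p) : Type := Fin (2 * (j : ℕ) + 1) → k

variable {k} (j : Fin p)

noncomputable instance : Module (Dres k p) (Ladder k p j) :=
  Module.compHom (Fin (2 * (j : ℕ) + 1) → k) (ladderRep k j).toRingHom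

theorem smul_ladder (d : Dres k p) (f : Ladder k p j) : d • f = ladderRep k j d f := rfl

instance : IsScalarTower k (Dres k p) (Ladder k p j) :=
  IsScalarTower.of_algebraMap_smul fun c f => by
    rw [smul_ladder, AlgHom.commutes]
    rfl

variable {j} (f : Ladder k p j)

theorem x1_smul_ladder : x1 k p • f = 0 := by
  rw [smul_ladder, ladderRep, x1, RingQuot.liftAlgHom_mkAlgHom_apply, fx1, FreeAlgebra.lift_ι_apply]
  rfl

theorem u1_smul_ladder : u1 k p • f = 0 := by
  rw [smul_ladder, ladderRep, u1, RingQuot.liftAlgHom_mkAlgHom_apply, fu1, FreeAlgebra.lift_ι_apply]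
  rfl

theorem g_smul_ladder : g k p • f = f := by
  rw [smul_ladder, ladderRep, g, RingQuot.liftAlgHom_mkAlgHom_apply, fg, FreeAlgebra.lift_ι_apply]
  rfl

theorem x2_smul_ladder : x2 k p • f = raise k j f := by
  rw [smul_ladder, ladderRep, x2, RingQuot.liftAlgHom_mkAlgHom_apply, fx2, FreeAlgebra.lift_ι_apply]
  rfl

theorem u2_smul_ladder : u2 k p • f = lower k j f := by
  rw [smul_ladder, ladderRep, u2, RingQuot.liftAlgHom_mkAlgHom_apply, fu2, FreeAlgebra.lift_ι_apply]
  rfl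

theorem z_smul_ladder : z k p • f = weight k j f := by
  rw [smul_ladder, ladderRep, z, RingQuot.liftAlgHom_mkAlgHom_apply, fz, FreeAlgebra.lift_ι_apply]
  rfl

omit [Fact p.Prime] [CharP k p] in
theorem finrank_ladder : Module.finrank k (Ladder k p j) = 2 * (j : ℕ) + 1 :=
  Module.finrank_fin_fun k

variable (k j) in
/-- The highest weight vector of `Ladder k p j`. -/
def Ladder.top : Ladder k p j := Pi.single 0 1

theorem x2_pow_smul_top (i : Fin (2 * (j : ℕ) + 1)) :
    x2 k p ^ (i : ℕ) • Ladder.top k j = Pi.single i 1 := by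
  induction i using Fin.induction with
  | zero => simp [Ladder.top]
  | succ i ih =>
    rw [Fin.val_castSucc] at ih
    rw [Fin.val_succ, pow_succ', mul_smul, ih, x2_smul_ladder]
    refine funext fun l => ?_
    refine Fin.cases ?_ (fun l => ?_) l
    · simp [(Fin.succ_ne_zero i).symm]
    · simp [Pi.single_apply]

theorem eq_smul_top (hu : u2 k p • f = 0) : f = f 0 • Ladder.top k j := by
  rw [u2_smul_ladder] at hu
  refine funext fun i => ?_
  refine Fin.cases ?_ (fun i => ?_) i
  · simp [Ladder.top]
  · have h := congrFun hu i.castSucc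
    rw [lower_castSucc] at h
    have h0 : f i.succ = 0 := (mul_eq_zero.mp h).resolve_left
      (ladderCoeff_ne_zero j.isLt (by omega) (by omega))
    simp [Ladder.top, h0]

instance isSimpleModule_ladder : IsSimpleModule (Dres k p) (Ladder k p j) := by
  have top_ne : Ladder.top k j ≠ 0 := fun h => one_ne_zero (α := k) <| by
    simpa [Ladder.top] using congrFun h 0
  refine { exists_pair_ne := ⟨⊥, ⊤, ?_⟩, eq_bot_or_eq_top := fun N => ?_ }
  · exact fun h => top_ne ((Submodule.mem_bot (Dres k p)).mp (h ▸ Submodule.mem_top))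
  refine or_iff_not_imp_left.mpr fun hN => ?_
  obtain ⟨f, hfN, hf⟩ := N.exists_mem_ne_zero_of_ne_bot hN
  obtain ⟨f, hf, hfN, hu⟩ := exists_smul_eq_zero (u2_pow (k := k) (p := p))
    (P := fun f => f ∈ N) (fun f hf => N.smul_mem _ hf) hf hfN
  rw [eq_smul_top f hu] at hf hfN
  have h0 : f 0 ≠ 0 := fun h => hf (by rw [h, zero_smul])
  have htop : Ladder.top k j ∈ N := by
    simpa [smul_smul, h0] using N.smul_of_tower_mem (f 0)⁻¹ hfN
  refine eq_top_iff.mpr fun h _ => ?_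
  have hsum : h = ∑ i : Fin (2 * (j : ℕ) + 1), (h i : k) • x2 k p ^ (i : ℕ) • Ladder.top k j := by
    simp only [x2_pow_smul_top]
    exact pi_eq_sum_univ' h
  rw [hsum]
  exact N.sum_mem fun i _ => N.smul_of_tower_mem _ (N.smul_mem _ htop)

end Ladder

section Classification

variable {k : Type} [Field k] {p : ℕ} [Fact p.Prime] [CharP k p]
  {M : Type*} [AddCommGroup M] [Module (Dres k p) M] [Module k M] [IsScalarTower k (Dres k p) M]

/-- The linear map from the ladder to `M` sending the basis vectors to `x2 ^ i • v`. -/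
noncomputable def ladderMap (j : Fin p) (v : M) : Ladder k p j →ₗ[k] M :=
  Fintype.linearCombination k fun i : Fin (2 * (j : ℕ) + 1) => x2 k p ^ (i : ℕ) • v

omit [Fact p.Prime] [CharP k p] [IsScalarTower k (Dres k p) M] in
theorem ladderMap_apply (j : Fin p) (v : M) (f : Ladder k p j) :
    ladderMap j v f = ∑ i : Fin (2 * (j : ℕ) + 1), (f i : k) • x2 k p ^ (i : ℕ) • v := rfl

theorem ladderMap_smul [IsSimpleModule (Dres k p) M] {j : Fin p} {v : M}
    (hu : u2 k p • v = 0) (hz : z k p • v = (-(j : ℕ) : k) • v) (d : Dres k p)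
    (f : Ladder k p j) : ladderMap j v (d • f) = d • ladderMap j v f := by
  have hM := isInvariant_of_isSimpleModule (k := k) (p := p) (M := M)
  have hlast : x2 k p ^ (2 * (j : ℕ) + 1) • v = 0 :=
    x2_pow_smul_eq_zero hu hz (by rw [ladderCoeff_odd, add_neg_cancel])
  induction d using Dres.induction generalizing f with
  | scalar c => rw [algebraMap_smul, algebraMap_smul, map_smul]
  | hx1 => rw [x1_smul_ladder, (hM _).x1_smul, map_zero]
  | hu1 => rw [u1_smul_ladder, (hM _).u1_smul, map_zero]
  | hg => rw [g_smul_ladder, (hM _).g_smul]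
  | hx2 =>
    rw [x2_smul_ladder, ladderMap_apply, ladderMap_apply, Fin.sum_univ_succ,
      Fin.sum_univ_castSucc, smul_add, Finset.smul_sum]
    simp only [raise_zero, raise_succ, Fin.val_succ, Fin.val_castSucc, Fin.val_last, zero_smul,
      smul_comm (x2 k p), ← mul_smul (x2 k p), ← pow_succ', hlast, smul_zero, zero_add, add_zero]
  | hu2 =>
    rw [u2_smul_ladder, ladderMap_apply, ladderMap_apply, Fin.sum_univ_succ (fun i => f i • _),
      Fin.sum_univ_castSucc, smul_add, Finset.smul_sum]
    simp only [lower_last, lower_castSucc, Fin.val_succ, Fin.val_castSucc, Fin.val_zero, zero_smul,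
      smul_comm (u2 k p), u2_smul_x2_pow hM hu hz, pow_zero, one_smul, hu, smul_zero, zero_add,
      add_zero, smul_smul, mul_comm]
  | hz =>
    rw [z_smul_ladder, ladderMap_apply, ladderMap_apply, Finset.smul_sum]
    simp only [weight_apply, smul_comm (z k p), z_smul_x2_pow hz, smul_smul, mul_comm]
  | mul a b ha hb => rw [mul_smul, mul_smul, ha, hb]
  | add a b ha hb => rw [add_smul, add_smul, map_add, ha, hb]

theorem exists_equiv_ladder [IsSimpleModule (Dres k p) M] :
    ∃ j : Fin p, Nonempty (M ≃ₗ[Dres k p] Ladder k p j) := by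
  obtain ⟨j, v, hv, hu, hz⟩ := exists_highestWeight (k := k) (p := p) (M := M)
  let φ : Ladder k p j →ₗ[Dres k p] M :=
    { toFun := ladderMap j v
      map_add' := map_add _
      map_smul' := ladderMap_smul hu hz }
  have hφ : φ (Ladder.top k j) = v := by
    refine (Fintype.linearCombination_apply_single k _ _ _).trans ?_
    simp
  have hbij := φ.bijective_or_eq_zero.resolve_right fun h => hv (by rw [← hφ, h]; rfl)
  exact ⟨j, ⟨(LinearEquiv.ofBijective φ hbij).symm⟩⟩

omit [Fact p.Prime] [CharP k p] in
theorem finrank_restrictScalars_of_equiv {N : Type*} [AddCommGroup N] [Module (Dres k p) N]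
    (e : N ≃ₗ[Dres k p] M) :
    Module.finrank k (RestrictScalars k (Dres k p) N) = Module.finrank k M :=
  LinearEquiv.finrank_eq
    { (RestrictScalars.addEquiv k (Dres k p) N).trans e.toAddEquiv with
      map_smul' := fun c m => by
        simp [RestrictScalars.addEquiv_map_smul] }

end Classification

end RestrictedDouble

open RestrictedDouble

/-- Up to isomorphism, `D_res` has exactly `p` simple modules,
of `k`-dimensions `1, 3, 5, …, 2p-1`: there are pairwise non-isomorphic simple
modules `L 0, …, L (p-1)` with `dim_k (L j) = 2j+1` such that every simple
`D_res`-module is isomorphic to exactly one of them. -/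
theorem restrictedDouble_simple_modules (p : ℕ) (hp : p.Prime) (hp2 : 2 < p)
    (k : Type) [Field k] [CharP k p] :
    ∃ L : Fin p → ModuleCat (Dres k p),
      (∀ j, IsSimpleModule (Dres k p) (L j)) ∧
      (∀ j, Module.finrank k (RestrictScalars k (Dres k p) (L j)) = 2 * (j : ℕ) + 1) ∧
      (∀ i j, i ≠ j → IsEmpty ((L i) ≃ₗ[Dres k p] (L j))) ∧
      (∀ (M : Type) [AddCommGroup M] [Module (Dres k p) M],
        IsSimpleModule (Dres k p) M → ∃! j, Nonempty (M ≃ₗ[Dres k p] (L j))) := by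
  have : Fact p.Prime := ⟨hp⟩
  have finrank_eq {N : Type _} [AddCommGroup N] [Module (Dres k p) N] (j : Fin p)
      (e : N ≃ₗ[Dres k p] Ladder k p j) :
      Module.finrank k (RestrictScalars k (Dres k p) N) = 2 * (j : ℕ) + 1 :=
    (finrank_restrictScalars_of_equiv e).trans finrank_ladder
  have hne (i j : Fin p) (hij : i ≠ j) (e : Ladder k p i ≃ₗ[Dres k p] Ladder k p j) : False := by
    have h := (finrank_eq i (.refl _ _)).symm.trans (finrank_eq j e)
    exact hij (Fin.ext (by omega))
  refine ⟨fun j => ModuleCat.of (Dres k p) (ULift (Ladder k p j)),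
    fun j => IsSimpleModule.congr ULift.moduleEquiv,
    fun j => (finrank_restrictScalars_of_equiv ULift.moduleEquiv).trans finrank_ladder,
    fun i j hij => ⟨fun e => hne i j hij
      ((ULift.moduleEquiv.symm.trans e).trans ULift.moduleEquiv)⟩, ?_⟩
  intro M _ _ hM
  let _ : Module k M := Module.compHom M (algebraMap k (Dres k p))
  have : IsScalarTower k (Dres k p) M := IsScalarTower.of_algebraMap_smul fun _ _ => rfl
  obtain ⟨j, ⟨e⟩⟩ := exists_equiv_ladder (k := k) (p := p) (M := M)
  refine ⟨j, ⟨e.trans ULift.moduleEquiv.symm⟩, fun i ⟨e'⟩ => ?_⟩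
  by_contra hij
  exact hne i j hij ((ULift.moduleEquiv.symm.trans e'.symm).trans e)
end

section
/- The linear maps c_V and c_W are bijective and each satisfies the braid equation (c⊗id)∘(id⊗c)∘(c⊗id) = (id⊗c)∘(c⊗id)∘(id⊗c); moreover the linear isomorphism φ : W → V given by φ(u1) = x1, φ(u2) = -x2 satisfies (φ⊗φ)∘c_W = c_V^{-1}∘(φ⊗φ), i.e. (W, c_W) is isomorphic to (V, c_V^{-1}) as braided vector spaces. -/
open scoped TensorProduct

namespace SuperJordanBraiding

variable (k : Type) [Field k]

/-- The underlying 2-dimensional vector space of `V` and `W`. -/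
abbrev Vec := Fin 2 → k

/-- The first basis vector (`x1` in `V`, `u1` in `W`). -/
noncomputable def b1 : Vec k := Pi.single 0 1

/-- The second basis vector (`x2` in `V`, `u2` in `W`). -/
noncomputable def b2 : Vec k := Pi.single 1 1

/-- The braid equation for an endomorphism of `Vec ⊗ Vec`. -/
def IsBraiding (c : Vec k ⊗[k] Vec k →ₗ[k] Vec k ⊗[k] Vec k) : Prop :=
  let c12 : (Vec k ⊗[k] Vec k) ⊗[k] Vec k →ₗ[k] (Vec k ⊗[k] Vec k) ⊗[k] Vec k :=
    c.rTensor (Vec k)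
  let c23 : (Vec k ⊗[k] Vec k) ⊗[k] Vec k →ₗ[k] (Vec k ⊗[k] Vec k) ⊗[k] Vec k :=
    (TensorProduct.assoc k (Vec k) (Vec k) (Vec k)).symm.toLinearMap ∘ₗ
      c.lTensor (Vec k) ∘ₗ (TensorProduct.assoc k (Vec k) (Vec k) (Vec k)).toLinearMap
  c12 ∘ₗ c23 ∘ₗ c12 = c23 ∘ₗ c12 ∘ₗ c23

end SuperJordanBraiding

open SuperJordanBraiding

namespace SuperJordanBraiding

variable (k : Type) [Field k]

theorem hom_ext_b {M : Type} [AddCommMonoid M] [Module k M] {f g : Vec k →ₗ[k] M}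
    (h1 : f (b1 k) = g (b1 k)) (h2 : f (b2 k) = g (b2 k)) : f = g := by
  refine LinearMap.pi_ext' fun i => LinearMap.ext_ring ?_
  fin_cases i
  · exact h1
  · exact h2

theorem tensor_hom_ext_b {M : Type} [AddCommMonoid M] [Module k M]
    {f g : Vec k ⊗[k] Vec k →ₗ[k] M}
    (h11 : f (b1 k ⊗ₜ b1 k) = g (b1 k ⊗ₜ b1 k)) (h12 : f (b1 k ⊗ₜ b2 k) = g (b1 k ⊗ₜ b2 k))
    (h21 : f (b2 k ⊗ₜ b1 k) = g (b2 k ⊗ₜ b1 k)) (h22 : f (b2 k ⊗ₜ b2 k) = g (b2 k ⊗ₜ b2 k)) :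
    f = g :=
  TensorProduct.ext (hom_ext_b k (hom_ext_b k h11 h12) (hom_ext_b k h21 h22))

/-- The Jordan block with eigenvalue `-1`. -/
noncomputable def jordan : Vec k →ₗ[k] Vec k :=
  (LinearMap.proj 1).smulRight (b1 k) - LinearMap.id

@[simp] theorem jordan_b1 : jordan k (b1 k) = -b1 k := by
  simp [jordan, b1]

@[simp] theorem jordan_b2 : jordan k (b2 k) = -b2 k + b1 k := by
  simp [jordan, b2, sub_eq_neg_add]

theorem jordan_comp_inv :
    jordan k ∘ₗ (-(LinearMap.proj 1).smulRight (b1 k) - LinearMap.id) = LinearMap.id := by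
  apply hom_ext_b <;> simp [jordan, b1, b2]

theorem inv_comp_jordan :
    (-(LinearMap.proj 1).smulRight (b1 k) - LinearMap.id) ∘ₗ jordan k = LinearMap.id := by
  apply hom_ext_b <;> simp [jordan, b1, b2]

/-- The Jordan block with eigenvalue `-1` as a linear automorphism. -/
noncomputable def jordanEquiv : Vec k ≃ₗ[k] Vec k :=
  LinearEquiv.ofLinearMap (jordan k) _ (jordan_comp_inv k) (inv_comp_jordan k)

variable {k}

theorem isBraiding_of_apply_left {c : Vec k ⊗[k] Vec k →ₗ[k] Vec k ⊗[k] Vec k}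
    {g : Vec k →ₗ[k] Vec k} (h : ∀ x y, c (x ⊗ₜ y) = g y ⊗ₜ x) : IsBraiding k c := by
  refine TensorProduct.ext_threefold fun x y z => ?_
  simp [h]

theorem isBraiding_of_apply_right {c : Vec k ⊗[k] Vec k →ₗ[k] Vec k ⊗[k] Vec k}
    {g : Vec k →ₗ[k] Vec k} (h : ∀ x y, c (x ⊗ₜ y) = y ⊗ₜ g x) : IsBraiding k c := by
  refine TensorProduct.ext_threefold fun x y z => ?_
  simp [h]

end SuperJordanBraiding

/-- The braiding `c_V` of the super Jordan plane
(`c_V(x_i ⊗ x1) = -x1 ⊗ x_i`, `c_V(x_i ⊗ x2) = (-x2 + x1) ⊗ x_i`) and the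
transpose braiding `c_W` (`c_W(u1 ⊗ u_i) = -u_i ⊗ u1`,
`c_W(u2 ⊗ u_i) = u_i ⊗ (u1 - u2)`) are bijective and satisfy the braid
equation, and the linear isomorphism `φ : W → V`, `φ(u1) = x1`, `φ(u2) = -x2`,
intertwines `c_W` with `c_V⁻¹`, i.e. `c_V ∘ (φ ⊗ φ) ∘ c_W = φ ⊗ φ`. -/
theorem superJordan_braidings (k : Type) [Field k] (hchar : (2 : k) ≠ 0)
    (cV cW : Vec k ⊗[k] Vec k →ₗ[k] Vec k ⊗[k] Vec k) (φ : Vec k →ₗ[k] Vec k)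
    -- defining values of `c_V` on the basis (`x1 = b1`, `x2 = b2`)
    (hV11 : cV (b1 k ⊗ₜ[k] b1 k) = -(b1 k ⊗ₜ[k] b1 k))
    (hV21 : cV (b2 k ⊗ₜ[k] b1 k) = -(b1 k ⊗ₜ[k] b2 k))
    (hV12 : cV (b1 k ⊗ₜ[k] b2 k) = (-(b2 k) + b1 k) ⊗ₜ[k] b1 k)
    (hV22 : cV (b2 k ⊗ₜ[k] b2 k) = (-(b2 k) + b1 k) ⊗ₜ[k] b2 k)
    -- defining values of `c_W` on the basis (`u1 = b1`, `u2 = b2`)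
    (hW11 : cW (b1 k ⊗ₜ[k] b1 k) = -(b1 k ⊗ₜ[k] b1 k))
    (hW12 : cW (b1 k ⊗ₜ[k] b2 k) = -(b2 k ⊗ₜ[k] b1 k))
    (hW21 : cW (b2 k ⊗ₜ[k] b1 k) = b1 k ⊗ₜ[k] (b1 k - b2 k))
    (hW22 : cW (b2 k ⊗ₜ[k] b2 k) = b2 k ⊗ₜ[k] (b1 k - b2 k))
    -- defining values of `φ`
    (hφ1 : φ (b1 k) = b1 k) (hφ2 : φ (b2 k) = -(b2 k)) :
    Function.Bijective cV ∧ Function.Bijective cW ∧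
    IsBraiding k cV ∧ IsBraiding k cW ∧
    Function.Bijective φ ∧
    cV ∘ₗ TensorProduct.map φ φ ∘ₗ cW = TensorProduct.map φ φ := by
  have hV : cV = ((TensorProduct.comm k (Vec k) (Vec k)).trans
      (TensorProduct.congr (jordanEquiv k) (LinearEquiv.refl k _))).toLinearMap := by
    apply tensor_hom_ext_b <;>
      simp [jordanEquiv, hV11, hV12, hV21, hV22, TensorProduct.neg_tmul]
  have hW : cW = ((TensorProduct.comm k (Vec k) (Vec k)).trans
      (TensorProduct.congr (LinearEquiv.refl k _) (jordanEquiv k))).toLinearMap := by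
    apply tensor_hom_ext_b <;>
      simp [jordanEquiv, hW11, hW12, hW21, hW22, TensorProduct.tmul_neg, sub_eq_neg_add]
  have hφ : Function.Involutive φ := by
    refine LinearMap.congr_fun (f := φ ∘ₗ φ) (g := LinearMap.id) (hom_ext_b k ?_ ?_) <;>
      simp [hφ1, hφ2]
  refine ⟨?_, ?_, ?_, ?_, hφ.bijective, ?_⟩
  · rw [hV]
    exact LinearEquiv.bijective _
  · rw [hW]
    exact LinearEquiv.bijective _
  · exact isBraiding_of_apply_left (g := jordan k) fun x y => by simp [hV, jordanEquiv]
  · exact isBraiding_of_apply_right (g := jordan k) fun x y => by simp [hW, jordanEquiv]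
  · apply tensor_hom_ext_b <;>
      simp [hW11, hW12, hW21, hW22, hφ1, hφ2, hV11, hV12, hV21, hV22, TensorProduct.tmul_neg,
        TensorProduct.neg_tmul, TensorProduct.tmul_sub, TensorProduct.add_tmul]
end

section
/- In the algebra U (the enveloping algebra of the Lie superalgebra osp(1|2), presented as an associative algebra), the elements e^p, f^p, h^p - h are central, and the k-subalgebra Z' they generate is isomorphic as a k-algebra to a polynomial ring in three variables k[X1, X2, X3] via X1 ↦ f^p, X2 ↦ h^p - h, X3 ↦ e^p. -/
/-!
The enveloping algebra `U = U(osp(1|2))` in characteristic `p`, presented as an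
associative algebra by generators e, f, h, ψ⁺, ψ⁻, realized as `RingQuot` of a
relation on the free algebra on 5 generators.
-/

namespace OspEnveloping

variable (k : Type) [Field k]

noncomputable def fe : FreeAlgebra k (Fin 5) := FreeAlgebra.ι k 0
noncomputable def ff : FreeAlgebra k (Fin 5) := FreeAlgebra.ι k 1
noncomputable def fh : FreeAlgebra k (Fin 5) := FreeAlgebra.ι k 2
noncomputable def fpp : FreeAlgebra k (Fin 5) := FreeAlgebra.ι k 3
noncomputable def fpm : FreeAlgebra k (Fin 5) := FreeAlgebra.ι k 4

/-- The defining relations of `U(osp(1|2))`. -/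
inductive Rel : FreeAlgebra k (Fin 5) → FreeAlgebra k (Fin 5) → Prop
  | he   : Rel (fh k * fe k) (fe k * fh k + 2 * fe k)
  | hf   : Rel (fh k * ff k) (ff k * fh k - 2 * ff k)
  | ef   : Rel (fe k * ff k) (ff k * fe k + fh k)
  | epp  : Rel (fe k * fpp k) (fpp k * fe k)
  | hpp  : Rel (fh k * fpp k) (fpp k * fh k + fpp k)
  | fpp' : Rel (ff k * fpp k) (fpp k * ff k + fpm k)
  | epm  : Rel (fe k * fpm k) (fpm k * fe k + fpp k)
  | hpm  : Rel (fh k * fpm k) (fpm k * fh k - fpm k)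
  | fpm' : Rel (ff k * fpm k) (fpm k * ff k)
  | ppsq : Rel (fpp k * fpp k) (fe k)
  | pmsq : Rel (fpm k * fpm k) (-(ff k))
  | pppm : Rel (fpp k * fpm k) (-(fpm k * fpp k) - fh k)

/-- The algebra `U(osp(1|2))`. -/
abbrev U := RingQuot (Rel k)

noncomputable def e : U k := RingQuot.mkAlgHom k (Rel k) (fe k)
noncomputable def f : U k := RingQuot.mkAlgHom k (Rel k) (ff k)
noncomputable def h : U k := RingQuot.mkAlgHom k (Rel k) (fh k)
noncomputable def pp : U k := RingQuot.mkAlgHom k (Rel k) (fpp k)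
noncomputable def pm : U k := RingQuot.mkAlgHom k (Rel k) (fpm k)

end OspEnveloping

open OspEnveloping

namespace OspEnveloping

section Center

variable (k : Type) [Field k]

theorem pp_mul_pp : pp k * pp k = e k := by
  simpa [pp, e] using RingQuot.mkAlgHom_rel k (Rel.ppsq (k := k))

theorem pm_mul_pm : pm k * pm k = -f k := by
  simpa [pm, f] using RingQuot.mkAlgHom_rel k (Rel.pmsq (k := k))

theorem pp_mul_pm : pp k * pm k = -(pm k * pp k) - h k := by
  simpa [pp, pm, h] using RingQuot.mkAlgHom_rel k (Rel.pppm (k := k))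

theorem e_mul_pp : e k * pp k = pp k * e k := by
  simpa [pp, e] using RingQuot.mkAlgHom_rel k (Rel.epp (k := k))

theorem e_mul_pm : e k * pm k = pm k * e k + pp k := by
  simpa [pp, pm, e] using RingQuot.mkAlgHom_rel k (Rel.epm (k := k))

theorem f_mul_pp : f k * pp k = pp k * f k + pm k := by
  simpa [pp, pm, f] using RingQuot.mkAlgHom_rel k (Rel.fpp' (k := k))

theorem f_mul_pm : f k * pm k = pm k * f k := by
  simpa [pm, f] using RingQuot.mkAlgHom_rel k (Rel.fpm' (k := k))

theorem h_mul_pp : h k * pp k = pp k * (h k + 1) := by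
  simpa [pp, h, mul_add] using RingQuot.mkAlgHom_rel k (Rel.hpp (k := k))

theorem h_mul_pm : h k * pm k = pm k * (h k - 1) := by
  simpa [pm, h, mul_sub] using RingQuot.mkAlgHom_rel k (Rel.hpm (k := k))

theorem adjoin_pp_pm : Algebra.adjoin k {pp k, pm k} = (⊤ : Subalgebra k (U k)) := by
  set S := Algebra.adjoin k {pp k, pm k}
  have hpp : pp k ∈ S := Algebra.subset_adjoin (by simp)
  have hpm : pm k ∈ S := Algebra.subset_adjoin (by simp)
  have he : e k ∈ S := pp_mul_pp k ▸ mul_mem hpp hpp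
  have hf : f k ∈ S := by
    rw [show f k = -(pm k * pm k) by simp [pm_mul_pm]]
    exact neg_mem (mul_mem hpm hpm)
  have hh : h k ∈ S := by
    rw [show h k = -(pm k * pp k) - pp k * pm k by simp [pp_mul_pm]]
    exact sub_mem (neg_mem (mul_mem hpm hpp)) (mul_mem hpp hpm)
  rw [eq_top_iff]
  rintro x -
  obtain ⟨y, rfl⟩ := RingQuot.mkAlgHom_surjective k (Rel k) x
  induction y using FreeAlgebra.induction with
  | grade0 r => simp
  | grade1 i => fin_cases i <;> assumption
  | mul a b ha hb => simpa using mul_mem ha hb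
  | add a b ha hb => simpa using add_mem ha hb

variable {k}

theorem mem_center_of_commute {z : U k} (hpp : z * pp k = pp k * z) (hpm : z * pm k = pm k * z) :
    z ∈ Subalgebra.center k (U k) := by
  have hle : Algebra.adjoin k {pp k, pm k} ≤ Subalgebra.centralizer k {z} := by
    rw [Algebra.adjoin_le_iff]
    rintro x (rfl | rfl) <;>
      simpa only [SetLike.mem_coe, Subalgebra.mem_centralizer_iff, Set.mem_singleton_iff,
        forall_eq]
  rw [adjoin_pp_pm] at hle
  rw [Subalgebra.mem_center_iff]
  intro b
  exact ((Subalgebra.mem_centralizer_iff k).1 (hle (Algebra.mem_top (x := b))) z rfl).symm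

theorem pow_mul_of_mul_eq_mul_add {R : Type*} [Ring R] {a b c : R} (hab : a * b = b * a + c)
    (hac : a * c = c * a) (n : ℕ) : a ^ n * b = b * a ^ n + n * (c * a ^ (n - 1)) := by
  have hac' : SemiconjBy a c c := hac
  induction n with
  | zero => simp
  | succ n ih =>
    rw [pow_succ', mul_assoc, ih, mul_add, ← mul_assoc, hab, add_mul, Nat.cast_succ, add_mul,
      one_mul, ← (Nat.cast_commute n a).left_comm, Nat.add_sub_cancel]
    rcases n with _ | n
    · simp
    · rw [Nat.add_sub_cancel, ← mul_assoc a c, hac]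
      simp only [mul_assoc, pow_succ']
      abel

variable (k) (p : ℕ) [CharP k p]

theorem natCast_char_eq_zero : (p : U k) = 0 := by
  rw [← map_natCast (algebraMap k (U k)), CharP.cast_eq_zero, map_zero]

theorem e_pow_mem_center : e k ^ p ∈ Subalgebra.center k (U k) := by
  refine mem_center_of_commute (Commute.pow_left (e_mul_pp k) p) ?_
  rw [pow_mul_of_mul_eq_mul_add (e_mul_pm k) (e_mul_pp k), natCast_char_eq_zero, zero_mul,
    add_zero]

theorem f_pow_mem_center : f k ^ p ∈ Subalgebra.center k (U k) := by
  refine mem_center_of_commute ?_ (Commute.pow_left (f_mul_pm k) p)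
  rw [pow_mul_of_mul_eq_mul_add (f_mul_pp k) (f_mul_pm k), natCast_char_eq_zero, zero_mul,
    add_zero]

theorem h_pow_sub_mem_center [Fact p.Prime] : h k ^ p - h k ∈ Subalgebra.center k (U k) := by
  have hadd : (h k + 1) ^ p = h k ^ p + 1 := by
    simpa using congrArg (Polynomial.aeval (h k))
      (add_pow_char (Polynomial.X : Polynomial k) 1 p)
  have hsub : (h k - 1) ^ p = h k ^ p - 1 := by
    simpa using congrArg (Polynomial.aeval (h k))
      (sub_pow_char (Polynomial.X : Polynomial k) 1 (p := p))
  have hpp : SemiconjBy (pp k) (h k + 1) (h k) := (h_mul_pp k).symm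
  have hpm : SemiconjBy (pm k) (h k - 1) (h k) := (h_mul_pm k).symm
  apply mem_center_of_commute
  · rw [sub_mul, h_mul_pp, ← (hpp.pow_right p).eq, hadd, ← mul_sub]
    congr 1; abel
  · rw [sub_mul, h_mul_pm, ← (hpm.pow_right p).eq, hsub, ← mul_sub]
    congr 1; abel

end Center

section Representation

variable (k : Type) [Field k] (K : Type*) [Field K] [Algebra k K]

/-- The space underlying the weight modules of `U(osp(1|2))` with two-sided infinite weight
string; the two factors are the even and the odd part. -/
abbrev WeightSpace := (ℤ → K) × (ℤ → K)

variable {K} (s l c : K)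

/-- The action of `ψ⁺` on the weight module. -/
def actPP : Module.End K (WeightSpace K) where
  toFun v := (fun m => s⁻¹ * (c - m) * v.2 (m - 1), fun m => s⁻¹ * -(l + m + c) * v.1 m)
  map_add' v w := by ext <;> simp <;> ring
  map_smul' r v := by ext <;> simp <;> ring

/-- The action of `ψ⁻` on the weight module. -/
def actPM : Module.End K (WeightSpace K) where
  toFun v := (fun m => s * v.2 m, fun m => s * v.1 (m + 1))
  map_add' v w := by ext <;> simp <;> ring
  map_smul' r v := by ext <;> simp <;> ring

/-- The action of `h` on the weight module. -/
def actH : Module.End K (WeightSpace K) where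
  toFun v := (fun m => (l + 2 * m) * v.1 m, fun m => (l + 2 * m + 1) * v.2 m)
  map_add' v w := by ext <;> simp <;> ring
  map_smul' r v := by ext <;> simp <;> ring

variable {s} (hs : s ≠ 0)

/-- The weight module with parameters `s ≠ 0`, `l`, `c`, as a homomorphism from `U(osp(1|2))`. -/
noncomputable def weightRep : U k →ₐ[k] Module.End K (WeightSpace K) :=
  RingQuot.liftAlgHom k ⟨FreeAlgebra.lift k ![actPP s l c * actPP s l c,
    -(actPM s * actPM s), actH l, actPP s l c, actPM s], by
      intro a b hab
      induction hab <;>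
        simp only [fe, ff, fh, fpp, fpm, map_mul, map_add, map_sub, map_neg, map_ofNat,
          FreeAlgebra.lift_ι_apply, Matrix.cons_val] <;>
        refine LinearMap.ext fun v => ?_ <;>
        ext m <;>
        simp [actPP, actPM, actH, two_mul] <;>
        field_simp <;>
        ring_nf⟩

theorem weightRep_e : weightRep k l c hs (e k) = actPP s l c * actPP s l c := by
  simp [weightRep, e, fe]

theorem weightRep_f : weightRep k l c hs (f k) = -(actPM s * actPM s) := by
  simp [weightRep, f, ff]

theorem weightRep_h : weightRep k l c hs (h k) = actH l := by
  simp [weightRep, h, fh]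

theorem weightRep_pm : weightRep k l c hs (pm k) = actPM s := by
  simp [weightRep, pm, fpm]

variable (K) in
/-- The constant function `1`, an eigenvector for `ψ⁻` in the weight module. -/
def constVec : WeightSpace K := (fun _ => 1, fun _ => 1)

theorem actPM_constVec : actPM s (constVec K) = s • constVec K := by
  ext <;> simp [actPM, constVec]

theorem eq_smul_constVec_of_actPM_eq_smul (hs : s ≠ 0) {v : WeightSpace K}
    (hv : actPM s v = s • v) :
    v = v.1 0 • constVec K := by
  have h21 (m : ℤ) : v.2 m = v.1 m := by
    simpa [actPM, hs] using congrFun (congrArg Prod.fst hv) m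
  have h12 (m : ℤ) : v.1 (m + 1) = v.1 m := by
    simpa [actPM, hs, h21] using congrFun (congrArg Prod.snd hv) m
  have hconst (m : ℤ) : v.1 m = v.1 0 := by
    induction m with
    | zero => rfl
    | succ i ih => rw [h12, ih]
    | pred i ih => rw [← ih, ← h12, sub_add_cancel]
  ext m <;> simp [constVec, h21, hconst m]

theorem weightRep_constVec_of_mem_center {z : U k} (hz : z ∈ Subalgebra.center k (U k)) :
    weightRep k l c hs z (constVec K) =
      (weightRep k l c hs z (constVec K)).1 0 • constVec K := by
  apply eq_smul_constVec_of_actPM_eq_smul hs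
  rw [← map_smul, ← actPM_constVec, ← weightRep_pm k l c hs, ← Module.End.mul_apply,
    ← Module.End.mul_apply, ← map_mul, ← map_mul, (Subalgebra.mem_center_iff.1 hz (pm k))]

theorem weightRep_f_pow_constVec (n : ℕ) :
    weightRep k l c hs (f k ^ n) (constVec K) = (-s ^ 2) ^ n • constVec K := by
  have hf : (-(actPM s * actPM s)) (constVec K) = (-s ^ 2) • constVec K := by
    simp [actPM_constVec, smul_smul, sq]
  rw [map_pow, weightRep_f]
  induction n with
  | zero => simp
  | succ n ih => rw [pow_succ, Module.End.mul_apply, hf, map_smul, ih, smul_smul,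
      ← pow_succ']

theorem actH_pow_fst (n : ℕ) (v : WeightSpace K) (m : ℤ) :
    ((actH l ^ n) v).1 m = (l + 2 * m) ^ n * v.1 m := by
  induction n generalizing v with
  | zero => simp
  | succ n ih => rw [pow_succ, Module.End.mul_apply, ih, pow_succ, mul_assoc]; rfl

theorem weightRep_h_pow_sub_constVec_fst (n : ℕ) :
    (weightRep k l c hs (h k ^ n - h k) (constVec K)).1 0 = l ^ n - l := by
  have h1 := actH_pow_fst l 1 (constVec K) 0
  rw [pow_one] at h1
  rw [map_sub, map_pow, weightRep_h, LinearMap.sub_apply, Prod.fst_sub, Pi.sub_apply,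
    actH_pow_fst, h1]
  simp [constVec]

theorem actPP_mul_actPP_pow_constVec_fst (n : ℕ) (m : ℤ) :
    (((actPP s l c * actPP s l c) ^ n) (constVec K)).1 m =
      (-(s⁻¹ ^ 2)) ^ n * ∏ i ∈ Finset.range n, ((c + (i - m)) * (c + (l + m - 1 - i))) := by
  induction n generalizing m with
  | zero => simp [constVec]
  | succ n ih =>
    have key (v : WeightSpace K) : ((actPP s l c * actPP s l c) v).1 m =
        -(s⁻¹ ^ 2) * ((c - m) * (c + (l + m - 1))) * v.1 (m - 1) := by
      simp [actPP]; ring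
    rw [pow_succ', Module.End.mul_apply, key, ih, Finset.prod_range_succ', pow_succ]
    have hprod : ∏ i ∈ Finset.range n,
          ((c + (i - (m - 1 : ℤ))) * (c + (l + (m - 1 : ℤ) - 1 - i))) =
        ∏ i ∈ Finset.range n,
          ((c + ((i + 1 : ℕ) - m)) * (c + (l + m - 1 - (i + 1 : ℕ)))) :=
      Finset.prod_congr rfl fun i _ => by push_cast; ring
    rw [hprod]
    push_cast
    ring

theorem weightRep_e_pow_constVec_fst (n : ℕ) :
    (weightRep k l c hs (e k ^ n) (constVec K)).1 0 =
      (-(s⁻¹ ^ 2)) ^ n * ∏ i ∈ Finset.range n, ((c + i) * (c + (l - 1 - i))) := by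
  rw [map_pow, weightRep_e, actPP_mul_actPP_pow_constVec_fst]
  simp

end Representation

section Independence

theorem exists_prod_add_eq {K : Type*} [Field K] [IsAlgClosed K] {n : ℕ} (hn : n ≠ 0)
    (a b : ℕ → K) (w : K) : ∃ c : K, ∏ i ∈ Finset.range n, ((c + a i) * (c + b i)) = w := by
  let P : Polynomial K := ∏ i ∈ Finset.range n,
    ((Polynomial.X + Polynomial.C (a i)) * (Polynomial.X + Polynomial.C (b i)))
  have hmonic (i : ℕ) : ((Polynomial.X + Polynomial.C (a i)) *
      (Polynomial.X + Polynomial.C (b i))).Monic :=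
    (Polynomial.monic_X_add_C _).mul (Polynomial.monic_X_add_C _)
  have hdeg : P.natDegree = n * 2 := by
    rw [Polynomial.natDegree_prod_of_monic _ _ fun i _ => hmonic i]
    simp [(Polynomial.monic_X_add_C _).natDegree_mul (Polynomial.monic_X_add_C _)]
  have hdeg' : (P - Polynomial.C w).degree ≠ 0 := by
    intro h0
    have := Polynomial.natDegree_eq_zero_iff_degree_le_zero.2 h0.le
    rw [Polynomial.natDegree_sub_C, hdeg] at this
    omega
  obtain ⟨c, hc⟩ := IsAlgClosed.exists_root _ hdeg'
  refine ⟨c, ?_⟩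
  simpa [P, Polynomial.IsRoot, Polynomial.eval_prod, sub_eq_zero] using hc

theorem exists_pow_sub_self_eq {K : Type*} [Field K] [IsAlgClosed K] {n : ℕ} (hn : 1 < n)
    (w : K) : ∃ l : K, l ^ n - l = w := by
  have hdeg : (Polynomial.X ^ n - Polynomial.X - Polynomial.C w : Polynomial K).degree ≠ 0 := by
    intro h0
    have := Polynomial.natDegree_eq_zero_iff_degree_le_zero.2 h0.le
    rw [Polynomial.natDegree_sub_C, FiniteField.X_pow_card_sub_X_natDegree_eq K hn] at this
    omega
  obtain ⟨l, hl⟩ := IsAlgClosed.exists_root _ hdeg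
  exact ⟨l, by simpa [Polynomial.IsRoot, sub_eq_zero] using hl⟩

variable (k : Type) [Field k] (p : ℕ) [Fact p.Prime] [CharP k p]

theorem exists_weightRep_constVec {K : Type*} [Field K] [IsAlgClosed K] [Algebra k K]
    {x : K} (hx : x ≠ 0) (y z : K) : ∃ ρ : U k →ₐ[k] Module.End K (WeightSpace K),
      ρ (f k ^ p) (constVec K) = x • constVec K ∧
      ρ (h k ^ p - h k) (constVec K) = y • constVec K ∧
      ρ (e k ^ p) (constVec K) = z • constVec K := by
  have hp : p.Prime := Fact.out
  obtain ⟨r, hr⟩ := IsAlgClosed.exists_pow_nat_eq x hp.pos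
  obtain ⟨s, hs⟩ := IsAlgClosed.exists_pow_nat_eq (-r) two_pos
  have hs0 : s ≠ 0 := by
    rintro rfl
    apply hx
    rw [← hr, ← neg_neg r, ← hs]
    simp [hp.ne_zero]
  obtain ⟨l, hl⟩ := exists_pow_sub_self_eq hp.one_lt y
  have hu : (-(s⁻¹ ^ 2)) ^ p ≠ 0 := by simp [hs0]
  obtain ⟨c, hc⟩ := exists_prod_add_eq hp.ne_zero (fun i => (i : K)) (fun i => l - 1 - i)
    (((-(s⁻¹ ^ 2)) ^ p)⁻¹ * z)
  refine ⟨weightRep k l c hs0, ?_, ?_, ?_⟩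
  · rw [weightRep_f_pow_constVec, hs, neg_neg, hr]
  · rw [weightRep_constVec_of_mem_center k l c hs0 (h_pow_sub_mem_center k p),
      weightRep_h_pow_sub_constVec_fst, hl]
  · rw [weightRep_constVec_of_mem_center k l c hs0 (e_pow_mem_center k p),
      weightRep_e_pow_constVec_fst, hc, mul_inv_cancel_left₀ hu]

/-- The elements `f^p`, `h^p - h`, `e^p` as elements of the center. -/
noncomputable def centralTriple : Fin 3 → Subalgebra.center k (U k) :=
  ![⟨f k ^ p, f_pow_mem_center k p⟩, ⟨h k ^ p - h k, h_pow_sub_mem_center k p⟩,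
    ⟨e k ^ p, e_pow_mem_center k p⟩]

variable {k} in
theorem algebraicIndependent_centralTriple_of_isAlgClosed {K : Type*} [Field K] [IsAlgClosed K]
    [Algebra k K] {ξ : Fin 3 → K} (hξ : AlgebraicIndependent k ξ) :
    AlgebraicIndependent k (centralTriple k p) := by
  obtain ⟨ρ, hf, hh, he⟩ := exists_weightRep_constVec k p (hξ.ne_zero 0) (ξ 1) (ξ 2)
  have hρ (i : Fin 3) : ρ (centralTriple k p i) (constVec K) = ξ i • constVec K := by
    fin_cases i <;> assumption
  have key (q : MvPolynomial (Fin 3) k) :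
      ρ (MvPolynomial.aeval (centralTriple k p) q) (constVec K) =
        MvPolynomial.aeval ξ q • constVec K := by
    induction q using MvPolynomial.induction_on with
    | C a => simp
    | add q₁ q₂ h₁ h₂ => simp [h₁, h₂, add_smul]
    | mul_X q i h =>
      rw [map_mul, MvPolynomial.aeval_X, Subalgebra.coe_mul, map_mul, Module.End.mul_apply, hρ,
        map_smul, h, smul_smul, map_mul, MvPolynomial.aeval_X, mul_comm]
  rw [algebraicIndependent_iff]
  intro q hq
  have h0 := congrFun (congrArg Prod.fst (key q)) 0
  rw [hq] at h0
  apply algebraicIndependent_iff.1 hξ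
  simpa [constVec] using h0.symm

theorem algebraicIndependent_centralTriple : AlgebraicIndependent k (centralTriple k p) := by
  have hinj : Function.Injective (IsScalarTower.toAlgHom k (MvPolynomial (Fin 3) k)
      (AlgebraicClosure (FractionRing (MvPolynomial (Fin 3) k)))) := by
    rw [IsScalarTower.coe_toAlgHom', IsScalarTower.algebraMap_eq _
      (FractionRing (MvPolynomial (Fin 3) k)) _]
    exact (algebraMap (FractionRing (MvPolynomial (Fin 3) k)) _).injective.comp
      (IsFractionRing.injective (MvPolynomial (Fin 3) k) _)
  exact algebraicIndependent_centralTriple_of_isAlgClosed p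
    ((MvPolynomial.algebraicIndependent_X (Fin 3) k).map' hinj)

theorem map_val_adjoin_range_centralTriple :
    (Algebra.adjoin k (Set.range (centralTriple k p))).map (Subalgebra.center k (U k)).val =
      Algebra.adjoin k {f k ^ p, h k ^ p - h k, e k ^ p} := by
  rw [AlgHom.map_adjoin, ← Set.range_comp]
  congr 1
  ext x
  simp [centralTriple, Fin.exists_fin_succ, eq_comm]

end Independence

end OspEnveloping

/-- In `U(osp(1|2))` over a field of odd characteristic `p`,
the elements `e^p`, `f^p`, `h^p - h` are central, and the subalgebra `Z'` they
generate is a polynomial algebra `k[X1,X2,X3]` via `X1 ↦ f^p`, `X2 ↦ h^p - h`,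
`X3 ↦ e^p`. -/
theorem ospEnveloping_center (p : ℕ) (hp : p.Prime) (hp2 : 2 < p)
    (k : Type) [Field k] [CharP k p] :
    e k ^ p ∈ Subalgebra.center k (U k) ∧
    f k ^ p ∈ Subalgebra.center k (U k) ∧
    h k ^ p - h k ∈ Subalgebra.center k (U k) ∧
    ∃ φ : MvPolynomial (Fin 3) k ≃ₐ[k]
        (Algebra.adjoin k ({f k ^ p, h k ^ p - h k, e k ^ p} : Set (U k))),
      (φ (MvPolynomial.X 0) : U k) = f k ^ p ∧
      (φ (MvPolynomial.X 1) : U k) = h k ^ p - h k ∧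
      (φ (MvPolynomial.X 2) : U k) = e k ^ p := by
  have : Fact p.Prime := ⟨hp⟩
  let φ := (algebraicIndependent_centralTriple k p).aevalEquiv.trans
    (((Algebra.adjoin k (Set.range (centralTriple k p))).equivMapOfInjective
      (Subalgebra.center k (U k)).val Subtype.val_injective).trans
      (Subalgebra.equivOfEq _ _ (map_val_adjoin_range_centralTriple k p)))
  have hφ (i : Fin 3) : (φ (MvPolynomial.X i) : U k) = centralTriple k p i := by
    have hX := (algebraicIndependent_centralTriple k p).algebraMap_aevalEquiv (MvPolynomial.X i)
    rw [MvPolynomial.aeval_X] at hX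
    exact congrArg Subtype.val hX
  exact ⟨e_pow_mem_center k p, f_pow_mem_center k p, h_pow_sub_mem_center k p, φ,
    hφ 0, hφ 1, hφ 2⟩
end
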